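/- arXiv:1708.00485 — 3 statements merged into one kernel-verified Lean document; each statement's English description precedes it below -/
import Mathlib

section
/- Let d ∈ {2,3} and let Ω ⊂ ℝ^d be a bounded open set. There exists a constant C₁ = C₁(Ω) such that for all continuously differentiable vector fields u, v, w : ℝ^d → ℝ^d with compact support contained in Ω, |b(u,v,w)| ≤ C₁ ‖∇u‖ ‖∇v‖ ‖∇w‖. -/
open MeasureTheory

noncomputable section

/-- Partial derivative `∂_j f_i` at `x` of a vector field `f : ℝ^d → ℝ^d`. -/
def pd {d : ℕ} (f : (Fin d → ℝ) → (Fin d → ℝ)) (x : Fin d → ℝ) (j i : Fin d) : ℝ :=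
  fderiv ℝ f x (Pi.single j (1 : ℝ)) i

/-- Partial derivative `∂_j f` at `x` of a scalar function `f : ℝ^d → ℝ`. -/
def pdS {d : ℕ} (f : (Fin d → ℝ) → ℝ) (x : Fin d → ℝ) (j : Fin d) : ℝ :=
  fderiv ℝ f x (Pi.single j (1 : ℝ))

/-- Convective term `(u·∇v)_i` at `x`. -/
def conv {d : ℕ} (u v : (Fin d → ℝ) → (Fin d → ℝ)) (x : Fin d → ℝ) (i : Fin d) : ℝ :=
  ∑ j, u x j * pd v x j i

/-- Convective term `u·∇T` at `x` for a scalar `T`. -/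
def convS {d : ℕ} (u : (Fin d → ℝ) → (Fin d → ℝ)) (T : (Fin d → ℝ) → ℝ)
    (x : Fin d → ℝ) : ℝ :=
  ∑ j, u x j * pdS T x j

/-- Divergence `∇·u` at `x`. -/
def divg {d : ℕ} (u : (Fin d → ℝ) → (Fin d → ℝ)) (x : Fin d → ℝ) : ℝ :=
  ∑ j, pd u x j j

/-- Euclidean dot product on `ℝ^d`. -/
def dotv {d : ℕ} (a b : Fin d → ℝ) : ℝ := ∑ i, a i * b i

/-- `L²` norm of a vector field. -/
def l2norm {d : ℕ} (f : (Fin d → ℝ) → (Fin d → ℝ)) : ℝ :=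
  (∫ x, ∑ i, (f x i) ^ 2) ^ (1 / 2 : ℝ)

/-- `L²` norm of the Jacobian matrix of a vector field. -/
def gradNorm {d : ℕ} (f : (Fin d → ℝ) → (Fin d → ℝ)) : ℝ :=
  (∫ x, ∑ i, ∑ j, (pd f x j i) ^ 2) ^ (1 / 2 : ℝ)

/-- `L²` norm of a scalar function. -/
def l2normS {d : ℕ} (f : (Fin d → ℝ) → ℝ) : ℝ :=
  (∫ x, (f x) ^ 2) ^ (1 / 2 : ℝ)

/-- `L²` norm of the gradient of a scalar function. -/
def gradNormS {d : ℕ} (f : (Fin d → ℝ) → ℝ) : ℝ :=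
  (∫ x, ∑ j, (pdS f x j) ^ 2) ^ (1 / 2 : ℝ)

/-- `L^p` norm of a scalar function. -/
def lpnormS {d : ℕ} (p : ℝ) (f : (Fin d → ℝ) → ℝ) : ℝ :=
  (∫ x, |f x| ^ p) ^ (1 / p)

/-- The explicitly skew-symmetric trilinear form
`b(u,v,w) = ½(u·∇v, w) − ½(u·∇w, v)`. -/
def bform {d : ℕ} (u v w : (Fin d → ℝ) → (Fin d → ℝ)) : ℝ :=
  (1 / 2) * (∫ x, dotv (conv u v x) (w x)) - (1 / 2) * (∫ x, dotv (conv u w x) (v x))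

/-- The explicitly skew-symmetric trilinear form
`b*(u,T,S) = ½(u·∇T, S) − ½(u·∇S, T)`. -/
def bstar {d : ℕ} (u : (Fin d → ℝ) → (Fin d → ℝ)) (T S : (Fin d → ℝ) → ℝ) : ℝ :=
  (1 / 2) * (∫ x, convS u T x * S x) - (1 / 2) * (∫ x, convS u S x * T x)

open scoped ENNReal NNReal

lemma aux_opnorm {d : ℕ} (L : (Fin d → ℝ) →L[ℝ] (Fin d → ℝ)) :
    ‖L‖ ≤ d * Real.sqrt (∑ i, ∑ j, (L (Pi.single j 1) i) ^ 2) := by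
  refine L.opNorm_le_bound (by positivity) fun y => ?_
  refine (pi_norm_le_iff_of_nonneg (by positivity)).2 fun i => ?_
  have h1 : L y i = ∑ j, y j * L (Pi.single j 1) i := by
    conv_lhs => rw [pi_eq_sum_univ' y]
    simp [map_sum, Finset.sum_apply]
  rw [h1]
  have hS : ∀ j, |L (Pi.single j 1) i| ≤ Real.sqrt (∑ i, ∑ j, (L (Pi.single j 1) i) ^ 2) := by
    intro j
    apply Real.abs_le_sqrt
    calc (L (Pi.single j 1) i) ^ 2 ≤ ∑ j, (L (Pi.single j 1) i) ^ 2 :=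
          Finset.single_le_sum (f := fun j => (L (Pi.single j 1) i) ^ 2)
            (fun _ _ => sq_nonneg _) (Finset.mem_univ j)
      _ ≤ _ := Finset.single_le_sum (f := fun i => ∑ j, (L (Pi.single j 1) i) ^ 2)
            (fun _ _ => Finset.sum_nonneg fun _ _ => sq_nonneg _) (Finset.mem_univ i)
  calc ‖∑ j, y j * L (Pi.single j 1) i‖ ≤ ∑ j : Fin d, ‖y‖ * Real.sqrt (∑ i, ∑ j, (L (Pi.single j 1) i) ^ 2) := by
        refine norm_sum_le_of_le _ fun j _ => ?_
        rw [norm_mul]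
        exact mul_le_mul (norm_le_pi_norm y j) (hS j) (norm_nonneg _) (norm_nonneg _)
    _ = _ := by simp; ring

lemma aux_grad {d : ℕ} {u : (Fin d → ℝ) → (Fin d → ℝ)} (hu : ContDiff ℝ 1 u)
    (hc : HasCompactSupport u) :
    eLpNorm (fderiv ℝ u) 2 volume ≤ ENNReal.ofReal (d * gradNorm u) := by
  have hcont : Continuous (fderiv ℝ u) := hu.continuous_fderiv one_ne_zero
  have hint : Integrable (fun x => ∑ i, ∑ j, (pd u x j i) ^ 2) := by
    apply Continuous.integrable_of_hasCompactSupport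
    · unfold pd; fun_prop
    · refine (hc.fderiv (𝕜 := ℝ)).mono fun x hx => ?_
      simp only [Function.mem_support] at hx ⊢
      intro h
      apply hx
      simp [pd, h]
  have hnn : ∀ x, 0 ≤ ∑ i, ∑ j, (pd u x j i) ^ 2 := fun x =>
    Finset.sum_nonneg fun _ _ => Finset.sum_nonneg fun _ _ => sq_nonneg _
  rw [eLpNorm_eq_lintegral_rpow_enorm_toReal (by norm_num) (by norm_num)]
  have h1 : ∫⁻ x, ‖fderiv ℝ u x‖ₑ ^ (2 : ℝ≥0∞).toReal ≤
      ENNReal.ofReal ((d : ℝ) ^ 2 * ∫ x, ∑ i, ∑ j, (pd u x j i) ^ 2) := by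
    rw [← integral_const_mul, ofReal_integral_eq_lintegral_ofReal (hint.const_mul _)
      (Filter.Eventually.of_forall fun x => mul_nonneg (by positivity) (hnn x))]
    refine lintegral_mono fun x => ?_
    simp only
    rw [← ofReal_norm_eq_enorm, ENNReal.ofReal_rpow_of_nonneg (norm_nonneg _) (by simp)]
    apply ENNReal.ofReal_le_ofReal
    have := pow_le_pow_left₀ (norm_nonneg _) (aux_opnorm (fderiv ℝ u x)) 2
    have hx := hnn x
    unfold pd at hx ⊢
    rw [mul_pow, Real.sq_sqrt hx] at this
    simpa using this
  refine (ENNReal.rpow_le_rpow h1 (by positivity)).trans ?_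
  have hI : 0 ≤ ∫ x, ∑ i, ∑ j, (pd u x j i) ^ 2 := integral_nonneg hnn
  rw [ENNReal.ofReal_rpow_of_nonneg (by positivity) (by positivity)]
  apply le_of_eq
  congr 1
  unfold gradNorm
  rw [Real.mul_rpow (by positivity) hI]
  congr 1
  rw [← Real.rpow_natCast, ← Real.rpow_mul (by positivity)]
  norm_num

lemma aux_hol {E F : Type*} [NormedAddCommGroup F] [MeasureSpace E] [TopologicalSpace E]
    [OpensMeasurableSpace E] [SecondCountableTopology E] {Ω : Set E} (hΩ : volume Ω ≠ ⊤) {f : E → F}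
    (hf : Continuous f) (hsup : f.support ⊆ Ω) :
    eLpNorm f ((4/3 : ℝ≥0) : ℝ≥0∞) volume ≤
      (((volume Ω).toNNReal ^ (1 / 4 : ℝ) : ℝ≥0) : ℝ≥0∞) * eLpNorm f 2 volume := by
  rw [← eLpNorm_restrict_eq_of_support_subset hsup,
    ← eLpNorm_restrict_eq_of_support_subset (p := 2) hsup]
  have hle : ((4/3 : ℝ≥0) : ℝ≥0∞) ≤ ((2 : ℝ≥0) : ℝ≥0∞) := by
    rw [ENNReal.coe_le_coe, ← NNReal.coe_le_coe]; norm_num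
  have := eLpNorm_le_eLpNorm_mul_rpow_measure_univ hle (μ := volume.restrict Ω)
    hf.aestronglyMeasurable
  refine this.trans (le_of_eq ?_)
  rw [mul_comm, ENNReal.coe_rpow_of_nonneg _ (by norm_num),
    ENNReal.coe_toNNReal hΩ, Measure.restrict_apply_univ]
  congr 2
  simp only [ENNReal.coe_toReal]
  norm_num

lemma aux_sob {d : ℕ} (hd : d = 2 ∨ d = 3)
    (Ω : Set (Fin d → ℝ)) (hΩb : Bornology.IsBounded Ω) :
    ∃ C : ℝ≥0, ∀ u : (Fin d → ℝ) → (Fin d → ℝ), ContDiff ℝ 1 u → tsupport u ⊆ Ω →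
      eLpNorm u 4 volume ≤ C * eLpNorm (fderiv ℝ u) 2 volume := by
  rcases hd with rfl | rfl
  · refine ⟨eLpNormLESNormFDerivOfLeConst (Fin 2 → ℝ) volume Ω (4/3) 4 *
      (volume Ω).toNNReal ^ (1 / 4 : ℝ), fun u hu hs => ?_⟩
    have h := eLpNorm_le_eLpNorm_fderiv_of_le (volume : Measure (Fin 2 → ℝ)) hu
      ((subset_tsupport u).trans hs) (p := 4/3) (q := 4)
      (by rw [← NNReal.coe_le_coe]; norm_num)
      (by rw [← NNReal.coe_lt_coe]; norm_num) (by norm_num) hΩb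
    refine (h.trans ?_)
    rw [ENNReal.coe_mul, mul_assoc]
    gcongr
    have hsup : (fderiv ℝ u).support ⊆ Ω := (support_fderiv_subset ℝ).trans hs
    exact aux_hol hΩb.measure_lt_top.ne (hu.continuous_fderiv one_ne_zero) hsup
  · refine ⟨eLpNormLESNormFDerivOfLeConst (Fin 3 → ℝ) volume Ω 2 4, fun u hu hs => ?_⟩
    exact eLpNorm_le_eLpNorm_fderiv_of_le (volume : Measure (Fin 3 → ℝ)) hu
      ((subset_tsupport u).trans hs) (p := 2) (q := 4) (by norm_num)
      (by rw [← NNReal.coe_lt_coe]; norm_num) (by norm_num) hΩb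

lemma aux_pt {d : ℕ} (u v w : (Fin d → ℝ) → (Fin d → ℝ)) (x : Fin d → ℝ) :
    ‖dotv (conv u v x) (w x)‖ ≤ (d : ℝ) ^ 2 * (‖fderiv ℝ v x‖ * (‖u x‖ * ‖w x‖)) := by
  unfold dotv conv
  have hp : ∀ j i, ‖pd v x j i‖ ≤ ‖fderiv ℝ v x‖ := fun j i => by
    have h1 := (fderiv ℝ v x).le_opNorm (Pi.single j (1 : ℝ))
    rw [Pi.norm_single, norm_one, mul_one] at h1
    exact (norm_le_pi_norm (fderiv ℝ v x (Pi.single j (1 : ℝ))) i).trans h1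
  calc _ ≤ ∑ i : Fin d, (∑ j : Fin d, ‖u x‖ * ‖fderiv ℝ v x‖) * ‖w x‖ := by
        refine norm_sum_le_of_le _ fun i _ => ?_
        rw [norm_mul]
        refine mul_le_mul ?_ (norm_le_pi_norm _ i) (norm_nonneg _) (by positivity)
        refine norm_sum_le_of_le _ fun j _ => ?_
        rw [norm_mul]
        exact mul_le_mul (norm_le_pi_norm _ j) (hp j i) (norm_nonneg _) (norm_nonneg _)
    _ = _ := by simp; ring

lemma aux_tri {d : ℕ} {u v w : (Fin d → ℝ) → (Fin d → ℝ)}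
    (hu : ContDiff ℝ 1 u) (hv : ContDiff ℝ 1 v) (hw : ContDiff ℝ 1 w) :
    ‖∫ x, dotv (conv u v x) (w x)‖ₑ ≤ ((d ^ 2 : ℝ≥0) : ℝ≥0∞) *
      (eLpNorm (fderiv ℝ v) 2 volume * (eLpNorm u 4 volume * eLpNorm w 4 volume)) := by
  have hvc := hv.continuous_fderiv one_ne_zero
  have huc := hu.continuous
  have hwc := hw.continuous
  have : ENNReal.HolderTriple 4 4 2 := ⟨by
    have : (4 : ℝ≥0∞) = 2 * 2 := by norm_num
    rw [this, ENNReal.mul_inv (by simp) (by simp), ← two_mul, ← mul_assoc,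
      ENNReal.mul_inv_cancel (by simp) (by simp), one_mul]⟩
  refine (enorm_integral_le_lintegral_enorm _).trans ?_
  rw [← eLpNorm_one_eq_lintegral_enorm]
  have h1 : eLpNorm (fun x => ‖u x‖ * ‖w x‖) 2 volume ≤ eLpNorm u 4 volume * eLpNorm w 4 volume := by
    have := eLpNorm_le_eLpNorm_mul_eLpNorm_of_nnnorm (p := 4) (q := 4) (r := 2) (μ := volume)
      huc.aestronglyMeasurable hwc.aestronglyMeasurable (fun a b => ‖a‖ * ‖b‖) 1
      (Filter.Eventually.of_forall fun x => by simp)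
    simpa using this
  have h2 := eLpNorm_le_eLpNorm_mul_eLpNorm_of_nnnorm (p := 2) (q := 2) (r := 1) (μ := volume)
      hvc.aestronglyMeasurable (huc.norm.mul hwc.norm).aestronglyMeasurable (fun a b => ‖a‖ * b) 1
      (Filter.Eventually.of_forall fun x => by simp)
  have h3 := eLpNorm_le_nnreal_smul_eLpNorm_of_ae_le_mul (c := (d : ℝ≥0) ^ 2) (p := 1)
    (μ := volume) (f := fun x => dotv (conv u v x) (w x))
    (g := fun x => ‖fderiv ℝ v x‖ * (‖u x‖ * ‖w x‖))
    (Filter.Eventually.of_forall fun x => by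
      have := aux_pt u v w x
      rw [← NNReal.coe_le_coe]
      simpa using this)
  refine h3.trans ?_
  rw [ENNReal.smul_def, smul_eq_mul]
  gcongr
  refine h2.trans ?_
  simp only [ENNReal.coe_one, one_mul]
  gcongr
  exact h1

lemma aux_gn {d : ℕ} (u : (Fin d → ℝ) → (Fin d → ℝ)) : 0 ≤ gradNorm u :=
  Real.rpow_nonneg (integral_nonneg fun _ =>
    Finset.sum_nonneg fun _ _ => Finset.sum_nonneg fun _ _ => sq_nonneg _) _

lemma aux_fin {d : ℕ} {Ω : Set (Fin d → ℝ)} {C : ℝ≥0}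
    (hC : ∀ u : (Fin d → ℝ) → (Fin d → ℝ), ContDiff ℝ 1 u → tsupport u ⊆ Ω →
      eLpNorm u 4 volume ≤ C * eLpNorm (fderiv ℝ u) 2 volume)
    {u v w : (Fin d → ℝ) → (Fin d → ℝ)}
    (hu : ContDiff ℝ 1 u) (hv : ContDiff ℝ 1 v) (hw : ContDiff ℝ 1 w)
    (cu : HasCompactSupport u) (cv : HasCompactSupport v) (cw : HasCompactSupport w)
    (su : tsupport u ⊆ Ω) (sw : tsupport w ⊆ Ω) :
    |∫ x, dotv (conv u v x) (w x)| ≤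
      d ^ 2 * ((d * gradNorm v) * ((C * (d * gradNorm u)) * (C * (d * gradNorm w)))) := by
  have gu := aux_gn u
  have gv := aux_gn v
  have gw := aux_gn w
  have h := aux_tri hu hv hw
  have h' : ‖∫ x, dotv (conv u v x) (w x)‖ₑ ≤ ENNReal.ofReal
      (d ^ 2 * ((d * gradNorm v) * ((C * (d * gradNorm u)) * (C * (d * gradNorm w))))) := by
    rw [ENNReal.ofReal_mul (by positivity), ENNReal.ofReal_mul (by positivity),
      ENNReal.ofReal_mul (p := C * (d * gradNorm u)) (by positivity),
      ENNReal.ofReal_mul (p := (C : ℝ)) (by positivity),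
      ENNReal.ofReal_mul (p := (C : ℝ)) (by positivity), ENNReal.ofReal_coe_nnreal]
    refine h.trans ?_
    have e : ((d ^ 2 : ℝ≥0) : ℝ≥0∞) = ENNReal.ofReal (d ^ 2) := by
      rw [← ENNReal.ofReal_coe_nnreal]; simp
    rw [e]
    gcongr
    · exact aux_grad hv cv
    · exact (hC u hu su).trans (by gcongr; exact aux_grad hu cu)
    · exact (hC w hw sw).trans (by gcongr; exact aux_grad hw cw)
  rw [← ofReal_norm_eq_enorm, ENNReal.ofReal_le_ofReal_iff (by positivity)] at h'
  exact h'

/-- For `d ∈ {2,3}` and a bounded open `Ω ⊂ ℝ^d`, there is `C₁ = C₁(Ω)`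
such that for all C¹ vector fields with compact support in `Ω`,
`|b(u,v,w)| ≤ C₁ ‖∇u‖ ‖∇v‖ ‖∇w‖`. -/
theorem statement2 {d : ℕ} (hd : d = 2 ∨ d = 3)
    (Ω : Set (Fin d → ℝ)) (hΩo : IsOpen Ω) (hΩb : Bornology.IsBounded Ω) :
    ∃ C₁ : ℝ, ∀ u v w : (Fin d → ℝ) → (Fin d → ℝ),
      ContDiff ℝ 1 u → ContDiff ℝ 1 v → ContDiff ℝ 1 w →
      HasCompactSupport u → HasCompactSupport v → HasCompactSupport w →
      tsupport u ⊆ Ω → tsupport v ⊆ Ω → tsupport w ⊆ Ω →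
      |bform u v w| ≤ C₁ * gradNorm u * gradNorm v * gradNorm w := by
  obtain ⟨C, hC⟩ := aux_sob hd Ω hΩb
  refine ⟨(d : ℝ) ^ 5 * C ^ 2, fun u v w hu hv hw cu cv cw su sv sw => ?_⟩
  have h1 := aux_fin hC hu hv hw cu cv cw su sw
  have h2 := aux_fin hC hu hw hv cu cw cv su sv
  unfold bform
  rw [abs_le] at *
  constructor <;> nlinarith [h1.1, h1.2, h2.1, h2.2]
end
end

section
/- Let Ω ⊂ ℝ³ be a bounded open set. There exists a constant C₅ = C₅(Ω) such that for all continuously differentiable vector fields u, v, w : ℝ³ → ℝ³ with compact support contained in Ω, |b(u,v,w)| ≤ C₅ ‖∇u‖ ‖∇v‖ √(‖w‖ ‖∇w‖). -/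
open MeasureTheory

noncomputable section

lemma pd_cont {u : (Fin 3 → ℝ) → (Fin 3 → ℝ)} (hu : ContDiff ℝ 1 u) (j i : Fin 3) :
    Continuous (fun x => pd u x j i) := by
  have h := hu.continuous_fderiv (by norm_num)
  unfold pd
  fun_prop

lemma pd_supp {u : (Fin 3 → ℝ) → (Fin 3 → ℝ)} (hu : HasCompactSupport u) (j i : Fin 3) :
    HasCompactSupport (fun x => pd u x j i) := by
  have h := hu.fderiv (𝕜 := ℝ)
  exact h.comp_left (g := fun L => L (Pi.single j 1) i) (by simp)

lemma abs_pd_le (u : (Fin 3 → ℝ) → (Fin 3 → ℝ)) (x : Fin 3 → ℝ) (j i : Fin 3) :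
    |pd u x j i| ≤ ‖fderiv ℝ u x‖ := by
  have h1 := norm_le_pi_norm (fderiv ℝ u x (Pi.single j (1 : ℝ))) i
  have h2 := (fderiv ℝ u x).le_opNorm (Pi.single j (1 : ℝ))
  simp only [Pi.norm_single, norm_one, mul_one] at h2
  exact h1.trans h2

lemma fderiv_sq_le (u : (Fin 3 → ℝ) → (Fin 3 → ℝ)) (x : Fin 3 → ℝ) :
    ‖fderiv ℝ u x‖ ^ 2 ≤ 9 * ∑ i, ∑ j, (pd u x j i) ^ 2 := by
  set S := ∑ i, ∑ j, (pd u x j i) ^ 2 with hS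
  have hS0 : 0 ≤ S := by positivity
  have hpd : ∀ i j, |pd u x j i| ≤ √S := by
    intro i j
    apply Real.abs_le_sqrt
    calc (pd u x j i)^2 ≤ ∑ j, (pd u x j i) ^ 2 :=
          Finset.single_le_sum (f := fun j => (pd u x j i)^2) (fun _ _ => sq_nonneg _) (Finset.mem_univ j)
      _ ≤ S := Finset.single_le_sum (f := fun i => ∑ j, (pd u x j i)^2)
          (fun _ _ => by positivity) (Finset.mem_univ i)
  have : ‖fderiv ℝ u x‖ ≤ 3 * √S := by
    apply ContinuousLinearMap.opNorm_le_bound _ (by positivity)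
    intro y
    rw [pi_norm_le_iff_of_nonneg (by positivity)]
    intro i
    have hy : fderiv ℝ u x y i = ∑ j, y j * pd u x j i := by
      conv_lhs => rw [pi_eq_sum_univ' y]
      simp [pd, map_sum, Finset.sum_apply]
    rw [hy]
    calc ‖∑ j, y j * pd u x j i‖ ≤ ∑ j, ‖y j * pd u x j i‖ := norm_sum_le _ _
      _ ≤ ∑ j : Fin 3, ‖y‖ * √S := by
        gcongr with j
        rw [norm_mul]
        exact mul_le_mul (norm_le_pi_norm y j) (hpd i j) (norm_nonneg _) (norm_nonneg _)
      _ = 3 * √S * ‖y‖ := by simp; ring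
  calc ‖fderiv ℝ u x‖ ^ 2 ≤ (3 * √S)^2 := by gcongr
    _ = 9 * S := by rw [mul_pow, Real.sq_sqrt hS0]; norm_num

lemma lint_le {f g : (Fin 3 → ℝ) → ℝ} (hg : Continuous g) (hgs : HasCompactSupport g)
    (h : ∀ x, f x ≤ g x) (h0 : ∀ x, 0 ≤ g x) :
    ∫⁻ x, ENNReal.ofReal (f x) ≤ ENNReal.ofReal (∫ x, g x) := by
  rw [ofReal_integral_eq_lintegral_ofReal (hg.integrable_of_hasCompactSupport hgs)
    (Filter.Eventually.of_forall h0)]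
  exact lintegral_mono fun x => ENNReal.ofReal_le_ofReal (h x)

lemma sum_supp {ι : Type*} (s : Finset ι) {f : ι → (Fin 3 → ℝ) → ℝ} (h : ∀ i, HasCompactSupport (f i)) :
    HasCompactSupport (fun x => ∑ i ∈ s, f i x) := by
  classical
  induction s using Finset.induction_on with
  | empty => simp only [Finset.sum_empty]; exact HasCompactSupport.zero
  | insert a s ha ih =>
    simp only [Finset.sum_insert ha]
    exact (h a).add ih

lemma D_le {u : (Fin 3 → ℝ) → (Fin 3 → ℝ)} (hu : ContDiff ℝ 1 u) (hs : HasCompactSupport u) :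
    (∫⁻ x, ‖fderiv ℝ u x‖ₑ ^ (2:ℝ)) ^ (1/2:ℝ) ≤ ENNReal.ofReal (3 * gradNorm u) := by
  have hI : 0 ≤ ∫ x, ∑ i, ∑ j, (pd u x j i) ^ 2 := integral_nonneg fun x => by positivity
  have h1 : ∫⁻ x, ‖fderiv ℝ u x‖ₑ ^ (2:ℝ) ≤ ENNReal.ofReal (∫ x, 9 * ∑ i, ∑ j, (pd u x j i) ^ 2) := by
    refine le_trans (le_of_eq ?_) (lint_le (f := fun x => ‖fderiv ℝ u x‖ ^ 2) ?_ ?_ (fderiv_sq_le u) ?_)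
    · congr 1; ext x
      rw [← ofReal_norm, ENNReal.ofReal_rpow_of_nonneg (norm_nonneg _) (by norm_num)]
      norm_num
    · have := pd_cont hu
      fun_prop
    · apply HasCompactSupport.mul_left
      refine sum_supp _ fun i => sum_supp _ fun j => ?_
      exact (pd_supp hs j i).comp_left (g := fun t => t ^ 2) (by simp)
    · intro x; positivity
  rw [integral_const_mul] at h1
  calc _ ≤ (ENNReal.ofReal (9 * ∫ x, ∑ i, ∑ j, (pd u x j i) ^ 2)) ^ (1/2:ℝ) := by gcongr
    _ = _ := by
      rw [ENNReal.ofReal_rpow_of_nonneg (by positivity) (by norm_num), Real.mul_rpow (by norm_num) hI, gradNorm]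
      congr 2
      rw [← Real.sqrt_eq_rpow, show (9:ℝ) = 3^2 by norm_num, Real.sqrt_sq (by norm_num)]

lemma W_le {u : (Fin 3 → ℝ) → (Fin 3 → ℝ)} (hu : ContDiff ℝ 1 u) (hs : HasCompactSupport u) :
    (∫⁻ x, ‖u x‖ₑ ^ (2:ℝ)) ^ (1/2:ℝ) ≤ ENNReal.ofReal (l2norm u) := by
  have hI : 0 ≤ ∫ x, ∑ i, (u x i) ^ 2 := integral_nonneg fun x => by positivity
  have h1 : ∫⁻ x, ‖u x‖ₑ ^ (2:ℝ) ≤ ENNReal.ofReal (∫ x, ∑ i, (u x i) ^ 2) := by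
    refine le_trans (le_of_eq ?_) (lint_le (f := fun x => ‖u x‖ ^ 2) ?_ ?_ ?_ ?_)
    · congr 1; ext x
      rw [← ofReal_norm, ENNReal.ofReal_rpow_of_nonneg (norm_nonneg _) (by norm_num)]
      norm_num
    · have := hu.continuous
      fun_prop
    · refine sum_supp _ fun i => ?_
      exact HasCompactSupport.comp_left (g := fun t : Fin 3 → ℝ => (t i) ^ 2) hs (by simp)
    · intro x
      have h0 : 0 ≤ ∑ i, (u x i) ^ 2 := by positivity
      have : ‖u x‖ ≤ √(∑ i, (u x i) ^ 2) := by
        rw [pi_norm_le_iff_of_nonneg (by positivity)]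
        intro i
        apply Real.abs_le_sqrt
        exact Finset.single_le_sum (f := fun i => (u x i)^2) (fun _ _ => sq_nonneg _) (Finset.mem_univ i)
      calc ‖u x‖^2 ≤ (√(∑ i, (u x i) ^ 2))^2 := by gcongr
        _ = _ := Real.sq_sqrt h0
    · intro x; positivity
  calc _ ≤ (ENNReal.ofReal (∫ x, ∑ i, (u x i) ^ 2)) ^ (1/2:ℝ) := by gcongr
    _ = _ := by
      rw [ENNReal.ofReal_rpow_of_nonneg (by positivity) (by norm_num), l2norm]

lemma sob : ∃ K : NNReal, ∀ u : (Fin 3 → ℝ) → (Fin 3 → ℝ), ContDiff ℝ 1 u → HasCompactSupport u →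
    (∫⁻ x, ‖u x‖ₑ ^ (6:ℝ)) ^ (1/6:ℝ) ≤ K * (∫⁻ x, ‖fderiv ℝ u x‖ₑ ^ (2:ℝ)) ^ (1/2:ℝ) := by
  refine ⟨SNormLESNormFDerivOfEqConst (Fin 3 → ℝ) (volume : Measure (Fin 3 → ℝ)) 2, fun u hu hs => ?_⟩
  have := eLpNorm_le_eLpNorm_fderiv_of_eq (volume : Measure (Fin 3 → ℝ)) hu hs (p := 2) (p' := 6)
    (by norm_num) (by simp) (by simp; norm_num)
  rw [eLpNorm_nnreal_eq_lintegral (by norm_num), eLpNorm_nnreal_eq_lintegral (by norm_num)] at this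
  simpa using this

lemma holder4 {a b c : (Fin 3 → ℝ) → ENNReal} (ha : Measurable a) (hb : Measurable b) (hc : Measurable c) :
    ∫⁻ x, a x * b x * c x ≤ (∫⁻ x, a x ^ (6:ℝ)) ^ (1/6:ℝ) * (∫⁻ x, b x ^ (2:ℝ)) ^ (1/2:ℝ)
      * (((∫⁻ x, c x ^ (2:ℝ)) ^ (1/2:ℝ)) ^ (1/2:ℝ) * ((∫⁻ x, c x ^ (6:ℝ)) ^ (1/6:ℝ))^(1/2:ℝ)) := by
  have := ENNReal.lintegral_prod_norm_pow_le (μ := (volume : Measure (Fin 3 → ℝ))) (Finset.univ : Finset (Fin 4))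
    (f := ![fun x => a x ^ (6:ℝ), fun x => b x ^ (2:ℝ), fun x => c x ^ (2:ℝ), fun x => c x ^ (6:ℝ)])
    (by intro i _; fin_cases i <;> simp <;> fun_prop) (p := ![1/6,1/2,1/4,1/12])
    (by simp [Fin.sum_univ_succ]; norm_num) (by intro i _; fin_cases i <;> simp)
  simp only [Fin.prod_univ_four] at this
  simp only [Matrix.cons_val] at this
  refine le_trans (le_of_eq ?_) (this.trans (le_of_eq ?_))
  · congr 1; ext x
    simp only [← ENNReal.rpow_mul]
    rw [mul_assoc (_ * _), ← ENNReal.rpow_add_of_nonneg _ _ (by norm_num) (by norm_num)]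
    norm_num
  · simp only [← ENNReal.rpow_mul]
    norm_num [mul_assoc]

lemma tri : ∃ K : ℝ, 0 ≤ K ∧ ∀ u v w : (Fin 3 → ℝ) → (Fin 3 → ℝ),
    ContDiff ℝ 1 u → ContDiff ℝ 1 v → ContDiff ℝ 1 w →
    HasCompactSupport u → HasCompactSupport v → HasCompactSupport w →
    ∫ x, ‖u x‖ * ‖fderiv ℝ v x‖ * ‖w x‖ ≤ K * gradNorm u * gradNorm v * √(l2norm w * gradNorm w) := by
  obtain ⟨K, hK⟩ := sob
  refine ⟨K * 3 * 3 * √(K * 3), by positivity, fun u v w hu hv hw su sv sw => ?_⟩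
  have hg : ∀ u : (Fin 3 → ℝ) → (Fin 3 → ℝ), 0 ≤ gradNorm u := fun u =>
    Real.rpow_nonneg (integral_nonneg fun x => by positivity) _
  have hl : ∀ u : (Fin 3 → ℝ) → (Fin 3 → ℝ), 0 ≤ l2norm u := fun u =>
    Real.rpow_nonneg (integral_nonneg fun x => by positivity) _
  have g1 := hg u
  have g2 := hg v
  have g3 := hg w
  have l3 := hl w
  have cu := hu.continuous
  have cw := hw.continuous
  have cv := hv.continuous_fderiv (by norm_num)
  have S : ∀ u : (Fin 3 → ℝ) → (Fin 3 → ℝ), ContDiff ℝ 1 u → HasCompactSupport u →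
      (∫⁻ x, ‖u x‖ₑ ^ (6:ℝ)) ^ (1/6:ℝ) ≤ ENNReal.ofReal (K * (3 * gradNorm u)) := by
    intro u hu su
    rw [ENNReal.ofReal_mul (by positivity), ENNReal.ofReal_coe_nnreal]
    exact (hK u hu su).trans (by gcongr; exact D_le hu su)
  rw [integral_eq_lintegral_of_nonneg_ae (Filter.Eventually.of_forall fun x => by positivity)
    (by fun_prop)]
  apply ENNReal.toReal_le_of_le_ofReal (by positivity)
  have := holder4 (a := fun x => ‖u x‖ₑ) (b := fun x => ‖fderiv ℝ v x‖ₑ) (c := fun x => ‖w x‖ₑ)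
    (by fun_prop) (by fun_prop) (by fun_prop)
  calc _ = ∫⁻ x, ‖u x‖ₑ * ‖fderiv ℝ v x‖ₑ * ‖w x‖ₑ := by
        congr 1; ext x
        rw [ENNReal.ofReal_mul (by positivity), ENNReal.ofReal_mul (by positivity)]
        simp only [ofReal_norm]
    _ ≤ _ := this
    _ ≤ ENNReal.ofReal (K * (3 * gradNorm u)) * ENNReal.ofReal (3 * gradNorm v) *
        (ENNReal.ofReal (l2norm w) ^ (1/2:ℝ) * ENNReal.ofReal (K * (3 * gradNorm w)) ^ (1/2:ℝ)) := by
        gcongr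
        · exact S u hu su
        · exact D_le hv sv
        · exact W_le hw sw
        · exact S w hw sw
    _ = _ := by
      rw [ENNReal.ofReal_rpow_of_nonneg (by positivity) (by norm_num),
        ENNReal.ofReal_rpow_of_nonneg (by positivity) (by norm_num),
        ← ENNReal.ofReal_mul (by positivity), ← ENNReal.ofReal_mul (by positivity),
        ← ENNReal.ofReal_mul (by positivity)]
      congr 1
      simp only [← Real.sqrt_eq_rpow]
      rw [← mul_assoc (K:ℝ) 3 (gradNorm w), Real.sqrt_mul (by positivity) (gradNorm w), Real.sqrt_mul l3]
      ring

lemma comp_cd {u : (Fin 3 → ℝ) → (Fin 3 → ℝ)} (hu : ContDiff ℝ 1 u) (i : Fin 3) :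
    ContDiff ℝ 1 (fun x => u x i) := by fun_prop

lemma comp_supp {u : (Fin 3 → ℝ) → (Fin 3 → ℝ)} (hu : HasCompactSupport u) (i : Fin 3) :
    HasCompactSupport (fun x => u x i) :=
  HasCompactSupport.comp_left (g := fun t : Fin 3 → ℝ => t i) hu (by simp)

lemma comp_fd {u : (Fin 3 → ℝ) → (Fin 3 → ℝ)} (hu : ContDiff ℝ 1 u) (x : Fin 3 → ℝ) (j i : Fin 3) :
    fderiv ℝ (fun x => u x i) x (Pi.single j 1) = pd u x j i := by
  have h : DifferentiableAt ℝ u x := hu.differentiable (by norm_num) x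
  have := (hasFDerivAt_pi'.1 h.hasFDerivAt i).fderiv
  rw [this]; rfl

lemma ibp {u v w : (Fin 3 → ℝ) → (Fin 3 → ℝ)}
    (hu : ContDiff ℝ 1 u) (hv : ContDiff ℝ 1 v) (hw : ContDiff ℝ 1 w)
    (sw : HasCompactSupport w) (i j : Fin 3) :
    ∫ x, u x j * pd w x j i * v x i =
      - ∫ x, (pd u x j j * v x i + u x j * pd v x j i) * w x i := by
  have cu := hu.continuous
  have cv := hv.continuous
  have cw := hw.continuous
  have pu := pd_cont hu j j
  have pv := pd_cont hv j i
  have pw := pd_cont hw j i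
  have hfd : ∀ x, fderiv ℝ (fun x => u x j * v x i) x (Pi.single j 1)
      = pd u x j j * v x i + u x j * pd v x j i := by
    intro x
    rw [fderiv_fun_mul ((comp_cd hu j).differentiable (by norm_num) x)
      ((comp_cd hv i).differentiable (by norm_num) x)]
    simp only [ContinuousLinearMap.add_apply, ContinuousLinearMap.smul_apply, comp_fd hu, comp_fd hv,
      smul_eq_mul]
    ring
  have := integral_mul_fderiv_eq_neg_fderiv_mul_of_integrable (μ := (volume : Measure (Fin 3 → ℝ)))
    (f := fun x => u x j * v x i) (g := fun x => w x i) (v := Pi.single j (1:ℝ))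
    (by
      simp only [hfd]
      exact Continuous.integrable_of_hasCompactSupport (by fun_prop) (comp_supp sw i).mul_left)
    (by
      simp only [comp_fd hw]
      exact Continuous.integrable_of_hasCompactSupport (by fun_prop) (pd_supp sw j i).mul_left)
    (Continuous.integrable_of_hasCompactSupport (by fun_prop) (comp_supp sw i).mul_left)
    (fun x _ => ((comp_cd hu j).mul (comp_cd hv i)).differentiable (by norm_num) x)
    (fun x _ => (comp_cd hw i).differentiable (by norm_num) x)
  simp only [hfd, comp_fd hw] at this
  rw [← this]
  congr 1; ext x; ring

lemma sum9 {f : Fin 3 → Fin 3 → ℝ} {B : ℝ} (h : ∀ i j, |f i j| ≤ B) : |∑ i, ∑ j, f i j| ≤ 9 * B := by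
  calc |∑ i, ∑ j, f i j| ≤ ∑ i, ∑ j, |f i j| :=
        (Finset.abs_sum_le_sum_abs _ _).trans (Finset.sum_le_sum fun i _ => Finset.abs_sum_le_sum_abs _ _)
    _ ≤ ∑ i : Fin 3, ∑ j : Fin 3, B := by gcongr with i _ j _; exact h i j
    _ = 9 * B := by simp; ring

lemma abs3 {a b c A B C : ℝ} (ha : |a| ≤ A) (hb : |b| ≤ B) (hc : |c| ≤ C) : |a * b * c| ≤ A * B * C := by
  have := (abs_nonneg a).trans ha
  have := (abs_nonneg b).trans hb
  rw [abs_mul, abs_mul]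
  gcongr

lemma abs_comp (u : (Fin 3 → ℝ) → (Fin 3 → ℝ)) (x) (i) : |u x i| ≤ ‖u x‖ := norm_le_pi_norm (u x) i

/-- For a bounded open `Ω ⊂ ℝ³`, there is `C₅ = C₅(Ω)` such that for all
C¹ vector fields `u, v, w : ℝ³ → ℝ³` with compact support in `Ω`,
`|b(u,v,w)| ≤ C₅ ‖∇u‖ ‖∇v‖ √(‖w‖ ‖∇w‖)`. -/
theorem statement6 (Ω : Set (Fin 3 → ℝ)) (hΩo : IsOpen Ω) (hΩb : Bornology.IsBounded Ω) :
    ∃ C₅ : ℝ, ∀ u v w : (Fin 3 → ℝ) → (Fin 3 → ℝ),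
      ContDiff ℝ 1 u → ContDiff ℝ 1 v → ContDiff ℝ 1 w →
      HasCompactSupport u → HasCompactSupport v → HasCompactSupport w →
      tsupport u ⊆ Ω → tsupport v ⊆ Ω → tsupport w ⊆ Ω →
      |bform u v w| ≤ C₅ * gradNorm u * gradNorm v * Real.sqrt (l2norm w * gradNorm w) := by
  obtain ⟨K, hK0, hK⟩ := tri
  refine ⟨14 * K, fun u v w hu hv hw su sv sw _ _ _ => ?_⟩
  have cu := hu.continuous
  have cv := hv.continuous
  have cw := hw.continuous
  have pu := pd_cont hu
  have pv := pd_cont hv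
  have pw := pd_cont hw
  have du := hu.continuous_fderiv (by norm_num)
  have dv := hv.continuous_fderiv (by norm_num)
  have k1 := hK u v w hu hv hw su sv sw
  have k2 := hK v u w hv hu hw sv su sw
  have i1 : Integrable (fun x => ‖u x‖ * ‖fderiv ℝ v x‖ * ‖w x‖) :=
    Continuous.integrable_of_hasCompactSupport (by fun_prop) sw.norm.mul_left
  have i2 : Integrable (fun x => ‖v x‖ * ‖fderiv ℝ u x‖ * ‖w x‖) :=
    Continuous.integrable_of_hasCompactSupport (by fun_prop) sw.norm.mul_left
  have t1 : |∫ x, dotv (conv u v x) (w x)| ≤ 9 * ∫ x, ‖u x‖ * ‖fderiv ℝ v x‖ * ‖w x‖ := by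
    rw [← integral_const_mul, ← Real.norm_eq_abs]
    refine norm_integral_le_of_norm_le (i1.const_mul 9) (Filter.Eventually.of_forall fun x => ?_)
    simp only [dotv, conv, Finset.sum_mul, Real.norm_eq_abs]
    exact sum9 fun i j => abs3 (abs_comp u x j) (abs_pd_le v x j i) (abs_comp w x i)
  have e2 : ∫ x, dotv (conv u w x) (v x) =
      - ∫ x, ∑ i, ∑ j, (pd u x j j * v x i + u x j * pd v x j i) * w x i := by
    simp only [dotv, conv, Finset.sum_mul]
    have a1 : ∀ i j, Integrable (fun x => u x j * pd w x j i * v x i) := fun i j =>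
      Continuous.integrable_of_hasCompactSupport (by fun_prop) (comp_supp sv i).mul_left
    have a2 : ∀ i j, Integrable (fun x => (pd u x j j * v x i + u x j * pd v x j i) * w x i) := fun i j =>
      Continuous.integrable_of_hasCompactSupport (by fun_prop) (comp_supp sw i).mul_left
    rw [integral_finset_sum _ fun i _ => integrable_finset_sum _ fun j _ => a1 i j,
      integral_finset_sum _ fun i _ => integrable_finset_sum _ fun j _ => a2 i j,
      ← Finset.sum_neg_distrib]
    refine Finset.sum_congr rfl fun i _ => ?_
    rw [integral_finset_sum _ fun j _ => a1 i j, integral_finset_sum _ fun j _ => a2 i j,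
      ← Finset.sum_neg_distrib]
    exact Finset.sum_congr rfl fun j _ => ibp hu hv hw sw i j
  have t2 : |∫ x, dotv (conv u w x) (v x)| ≤ 9 * ((∫ x, ‖v x‖ * ‖fderiv ℝ u x‖ * ‖w x‖)
      + ∫ x, ‖u x‖ * ‖fderiv ℝ v x‖ * ‖w x‖) := by
    rw [e2, abs_neg, ← integral_add i2 i1, ← integral_const_mul, ← Real.norm_eq_abs]
    refine norm_integral_le_of_norm_le ((i2.add i1).const_mul 9) (Filter.Eventually.of_forall fun x => ?_)
    rw [Real.norm_eq_abs]
    refine sum9 fun i j => ?_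
    rw [add_mul, mul_comm (pd u x j j)]
    exact (abs_add_le _ _).trans (add_le_add
      (abs3 (abs_comp v x i) (abs_pd_le u x j j) (abs_comp w x i))
      (abs3 (abs_comp u x j) (abs_pd_le v x j i) (abs_comp w x i)))
  have t3 : |bform u v w| ≤ 1/2 * |∫ x, dotv (conv u v x) (w x)| + 1/2 * |∫ x, dotv (conv u w x) (v x)| := by
    unfold bform
    refine (abs_sub _ _).trans (le_of_eq ?_)
    rw [abs_mul, abs_mul]; norm_num
  have hX : 0 ≤ K * gradNorm u * gradNorm v * √(l2norm w * gradNorm w) :=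
    (integral_nonneg fun x => by positivity).trans k1
  have k3 : ∫ x, ‖v x‖ * ‖fderiv ℝ u x‖ * ‖w x‖ ≤ K * gradNorm u * gradNorm v * √(l2norm w * gradNorm w) :=
    k2.trans (le_of_eq (by ring))
  have : 14 * K * gradNorm u * gradNorm v * √(l2norm w * gradNorm w)
    = 14 * (K * gradNorm u * gradNorm v * √(l2norm w * gradNorm w)) := by ring
  rw [this]
  linarith
end
end

section
/- Let Ω ⊂ ℝ³ be a bounded open set. There exists a constant C₆ = C₆(Ω) such that for every continuously differentiable vector field u : ℝ³ → ℝ³ and all continuously differentiable scalar functions T, S : ℝ³ → ℝ, all with compact support contained in Ω, |b*(u,T,S)| ≤ C₆ ‖∇u‖ ‖∇T‖ √(‖S‖ ‖∇S‖). -/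
open MeasureTheory

noncomputable section

abbrev E3 := Fin 3 → ℝ

lemma memLp_cc {f : E3 → ℝ} (hf : Continuous f) (hs : HasCompactSupport f) (p : ENNReal) :
    MemLp f p volume := hf.memLp_of_hasCompactSupport hs

lemma int_cc {f : E3 → ℝ} (hf : Continuous f) (hs : HasCompactSupport f) :
    Integrable f volume := hf.integrable_of_hasCompactSupport hs

lemma cs_cc {f g : E3 → ℝ} (hf : Continuous f) (hs : HasCompactSupport f)
    (hg : Continuous g) (gs : HasCompactSupport g) :
    |∫ x, f x * g x| ≤ Real.sqrt (∫ x, f x ^ 2) * Real.sqrt (∫ x, g x ^ 2) := by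
  have h := integral_mul_norm_le_Lp_mul_Lq (μ := (volume : Measure E3))
    Real.HolderConjugate.two_two (memLp_cc hf hs _) (memLp_cc hg gs _)
  rw [← Real.sqrt_eq_rpow, ← Real.sqrt_eq_rpow] at h
  simp only [Real.rpow_ofNat, Real.norm_eq_abs, sq_abs] at h
  refine le_trans (abs_integral_le_integral_abs) ?_
  simpa only [abs_mul] using h

lemma holder_cc {f g : E3 → ℝ} (hf : Continuous f) (hs : HasCompactSupport f)
    (hg : Continuous g) (gs : HasCompactSupport g) {a b : ℝ} (ha : 0 ≤ a) (hb : 0 ≤ b)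
    (hfa : ∫ x, f x ^ 6 ≤ a ^ 6) (hgb : ∫ x, g x ^ 6 ≤ b ^ 6) :
    ∫ x, f x ^ 2 * g x ^ 4 ≤ a ^ 2 * b ^ 4 := by
  have hc : Real.HolderConjugate 3 (3/2) := by
    rw [Real.holderConjugate_iff]; norm_num
  have s2 : HasCompactSupport (fun x => f x ^ 2) := hs.comp_left (g := fun t : ℝ => t ^ 2) (by simp)
  have s4 : HasCompactSupport (fun x => g x ^ 4) := gs.comp_left (g := fun t : ℝ => t ^ 4) (by simp)
  have h := integral_mul_norm_le_Lp_mul_Lq (μ := (volume : Measure E3))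
    hc (memLp_cc (hf.pow 2) s2 _) (memLp_cc (hg.pow 4) s4 _)
  have e1 : ∀ x, ‖f x ^ 2‖ ^ (3:ℝ) = f x ^ 6 := by
    intro x
    rw [Real.norm_of_nonneg (by positivity), show (3:ℝ) = ((3:ℕ):ℝ) by norm_num, Real.rpow_natCast]
    ring
  have e2 : ∀ x, ‖g x ^ 4‖ ^ (3/2:ℝ) = g x ^ 6 := by
    intro x
    rw [Real.norm_of_nonneg (by positivity), show g x ^ 4 = |g x| ^ 4 from (Even.pow_abs (by decide) _).symm,
      show g x ^ 6 = |g x| ^ 6 from (Even.pow_abs (by decide) _).symm, ← Real.rpow_natCast,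
      ← Real.rpow_mul (abs_nonneg _), ← Real.rpow_natCast]
    norm_num
  have e3 : ∀ x, ‖f x ^ 2‖ * ‖g x ^ 4‖ = f x ^ 2 * g x ^ 4 := by
    intro x
    rw [Real.norm_of_nonneg (by positivity), Real.norm_of_nonneg (by positivity)]
  simp only [Pi.pow_apply, e1, e2, e3] at h
  refine h.trans ?_
  have p6 : ∀ f : E3 → ℝ, 0 ≤ ∫ x, f x ^ 6 := fun f => integral_nonneg fun x => by positivity
  have k1 : (∫ x, f x ^ 6) ^ (1 / 3 : ℝ) ≤ a ^ 2 := by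
    calc _ ≤ (a ^ 6) ^ (1 / 3 : ℝ) := Real.rpow_le_rpow (p6 f) hfa (by norm_num)
      _ = a ^ 2 := by
        rw [← Real.rpow_natCast, ← Real.rpow_mul ha, ← Real.rpow_natCast]; norm_num
  have k2 : (∫ x, g x ^ 6) ^ (1 / (3 / 2) : ℝ) ≤ b ^ 4 := by
    calc _ ≤ (b ^ 6) ^ (1 / (3 / 2) : ℝ) := Real.rpow_le_rpow (p6 g) hgb (by norm_num)
      _ = b ^ 4 := by
        rw [← Real.rpow_natCast, ← Real.rpow_mul hb, ← Real.rpow_natCast]; norm_num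
  exact mul_le_mul k1 k2 (Real.rpow_nonneg (p6 g) _) (by positivity)

lemma trilin {p g S : E3 → ℝ} (hp : Continuous p) (ps : HasCompactSupport p)
    (hg : Continuous g) (gs : HasCompactSupport g)
    (hS : Continuous S) (Ss : HasCompactSupport S) {a b : ℝ} (ha : 0 ≤ a) (hb : 0 ≤ b)
    (hSa : ∫ x, S x ^ 6 ≤ a ^ 6) (hgb : ∫ x, g x ^ 6 ≤ b ^ 6) :
    |∫ x, p x * (g x * S x)| ≤
      Real.sqrt (∫ x, p x ^ 2) * (b * Real.sqrt (Real.sqrt (∫ x, S x ^ 2) * a)) := by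
  have h1 := holder_cc hS Ss hg gs ha hb hSa hgb
  have h2 := cs_cc hS Ss (hS.mul (hg.pow 2)) Ss.mul_right
  have h3 := cs_cc hp ps (hg.mul hS) gs.mul_right
  refine h3.trans ?_
  refine mul_le_mul_of_nonneg_left ?_ (Real.sqrt_nonneg _)
  have h4 : ∫ x, (g x * S x) ^ 2 ≤ b ^ 2 * (Real.sqrt (∫ x, S x ^ 2) * a) := by
    calc ∫ x, (g x * S x) ^ 2 = ∫ x, S x * (S x * g x ^ 2) := by
          congr 1; ext x; ring
      _ ≤ _ := (le_abs_self _).trans h2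
      _ ≤ Real.sqrt (∫ x, S x ^ 2) * Real.sqrt ((a * b ^ 2) ^ 2) := by
          gcongr
          refine le_trans (le_of_eq ?_) (h1.trans (le_of_eq (by ring)))
          congr 1; ext x; simp; ring
      _ = _ := by rw [Real.sqrt_sq (by positivity)]; ring
  calc _ ≤ Real.sqrt (b ^ 2 * (Real.sqrt (∫ x, S x ^ 2) * a)) := Real.sqrt_le_sqrt h4
    _ = _ := by rw [Real.sqrt_mul (by positivity), Real.sqrt_sq hb]

lemma cont_pdS {f : E3 → ℝ} (hf : ContDiff ℝ 1 f) (j : Fin 3) :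
    Continuous (fun x => pdS f x j) :=
  (hf.continuous_fderiv (by norm_num)).clm_apply continuous_const

lemma cs_pdS {f : E3 → ℝ} (hs : HasCompactSupport f) (j : Fin 3) :
    HasCompactSupport (fun x => pdS f x j) :=
  (hs.fderiv ℝ).comp_left (g := fun L : E3 →L[ℝ] ℝ => L (Pi.single j 1)) (by simp)

lemma cs_sq {f : E3 → ℝ} (hs : HasCompactSupport f) : HasCompactSupport (fun x => f x ^ 2) :=
  hs.comp_left (g := fun t : ℝ => t ^ 2) (by simp)

lemma norm_fderiv_sq_le (f : E3 → ℝ) (x : E3) :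
    ‖fderiv ℝ f x‖ ^ 2 ≤ 3 * ∑ j, pdS f x j ^ 2 := by
  have h : ‖fderiv ℝ f x‖ ≤ ∑ j, |pdS f x j| := by
    refine ContinuousLinearMap.opNorm_le_bound _ (by positivity) fun v => ?_
    have : fderiv ℝ f x v = ∑ j, v j * pdS f x j := by
      conv_lhs => rw [pi_eq_sum_univ' v]
      simp [pdS]
    rw [this, Finset.sum_mul]
    refine (norm_sum_le _ _).trans (Finset.sum_le_sum fun j _ => ?_)
    rw [norm_mul, mul_comm, Real.norm_eq_abs]
    exact mul_le_mul_of_nonneg_left (norm_le_pi_norm v j) (abs_nonneg _)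
  calc _ ≤ (∑ j, |pdS f x j|) ^ 2 := by gcongr
    _ ≤ _ := by
      have := sq_sum_le_card_mul_sum_sq (s := Finset.univ) (f := fun j => |pdS f x j|)
      simpa using this

lemma sobolev6 : ∃ K : ℝ, 0 ≤ K ∧ ∀ f : E3 → ℝ, ContDiff ℝ 1 f → HasCompactSupport f →
    ∫ x, f x ^ 6 ≤ (K * gradNormS f) ^ 6 := by
  set C := eLpNormLESNormFDerivOfEqInnerConst (volume : Measure E3) (2 : NNReal)
  refine ⟨C * Real.sqrt 3, by positivity, fun f hf hs => ?_⟩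
  have h := eLpNorm_le_eLpNorm_fderiv_of_eq_inner (volume : Measure E3) hf hs
    (p := 2) (p' := 6) (by norm_num) (by simp) (by simp; norm_num)
  have m1 : MemLp f (6:NNReal) volume := memLp_cc hf.continuous hs _
  have m2 : MemLp (fderiv ℝ f) (2:NNReal) volume :=
    (hf.continuous_fderiv (by norm_num)).memLp_of_hasCompactSupport (hs.fderiv ℝ)
  rw [m1.eLpNorm_eq_integral_rpow_norm (by norm_num) (by norm_num),
    m2.eLpNorm_eq_integral_rpow_norm (by norm_num) (by norm_num)] at h
  rw [← ENNReal.ofReal_coe_nnreal (p := eLpNormLESNormFDerivOfEqInnerConst _ _),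
    ← ENNReal.ofReal_mul (by positivity),
    ENNReal.ofReal_le_ofReal_iff (by positivity)] at h
  have t6 : ((6:NNReal):ENNReal).toReal = (6:ℝ) := by simp
  have t2 : ((2:NNReal):ENNReal).toReal = (2:ℝ) := by simp
  rw [t6, t2] at h
  have e1 : ∀ x, ‖f x‖ ^ (6:ℝ) = f x ^ 6 := by
    intro x
    rw [show (6:ℝ) = ((6:ℕ):ℝ) by norm_num, Real.rpow_natCast, Real.norm_eq_abs]
    exact Even.pow_abs (by decide) _
  simp only [e1, Real.rpow_ofNat] at h
  have p6 : 0 ≤ ∫ x, f x ^ 6 := integral_nonneg fun x => by positivity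
  have g2 : (∫ x, ‖fderiv ℝ f x‖ ^ 2) ^ ((2:ℝ)⁻¹) ≤ Real.sqrt 3 * gradNormS f := by
    unfold gradNormS
    rw [show (2:ℝ)⁻¹ = 1 / 2 by norm_num, ← Real.sqrt_eq_rpow, ← Real.sqrt_eq_rpow,
      ← Real.sqrt_mul (by norm_num)]
    apply Real.sqrt_le_sqrt
    rw [← integral_const_mul]
    refine integral_mono_of_nonneg (Filter.Eventually.of_forall fun x => by positivity) ?_
      (Filter.Eventually.of_forall fun x => norm_fderiv_sq_le f x)
    refine Integrable.const_mul (integrable_finsetSum _ fun j _ => ?_) _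
    exact int_cc ((cont_pdS hf j).pow 2) (cs_sq (cs_pdS hs j))
  have h2 : (∫ x, f x ^ 6) ^ ((6:ℝ)⁻¹) ≤ C * Real.sqrt 3 * gradNormS f := by
    refine h.trans ?_
    rw [mul_assoc]
    exact mul_le_mul_of_nonneg_left g2 C.2
  calc ∫ x, f x ^ 6 = ((∫ x, f x ^ 6) ^ ((6:ℝ)⁻¹)) ^ 6 := by
        rw [← Real.rpow_natCast, ← Real.rpow_mul p6]; norm_num
    _ ≤ _ := pow_le_pow_left₀ (Real.rpow_nonneg p6 _) h2 6

lemma gradNormS_nonneg (f : E3 → ℝ) : 0 ≤ gradNormS f :=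
  Real.rpow_nonneg (integral_nonneg fun x => Finset.sum_nonneg fun j _ => sq_nonneg _) _

lemma pdS_le {f : E3 → ℝ} (hf : ContDiff ℝ 1 f) (hs : HasCompactSupport f) (j : Fin 3) :
    Real.sqrt (∫ x, pdS f x j ^ 2) ≤ gradNormS f := by
  unfold gradNormS
  rw [← Real.sqrt_eq_rpow]
  apply Real.sqrt_le_sqrt
  refine integral_mono_of_nonneg (Filter.Eventually.of_forall fun x => sq_nonneg _) ?_
    (Filter.Eventually.of_forall fun x =>
      Finset.single_le_sum (f := fun j => pdS f x j ^ 2) (fun i _ => sq_nonneg _) (Finset.mem_univ j))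
  exact integrable_finsetSum _ fun j _ => int_cc ((cont_pdS hf j).pow 2) (cs_sq (cs_pdS hs j))

lemma pdS_comp {u : E3 → E3} (hu : ContDiff ℝ 1 u) (x : E3) (i j : Fin 3) :
    pdS (fun x => u x i) x j = pd u x j i := by
  unfold pdS pd
  rw [fderiv_apply (hu.differentiable (by norm_num) x)]
  simp

lemma gradNormS_comp_le {u : E3 → E3} (hu : ∀ i, ContDiff ℝ 1 (fun x => u x i))
    (hs : ∀ i, HasCompactSupport (fun x => u x i)) (i : Fin 3) :
    gradNormS (fun x => u x i) ≤ gradNorm u := by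
  have hu' : ContDiff ℝ 1 u := contDiff_pi.2 hu
  unfold gradNormS gradNorm
  simp only [← pdS_comp hu']
  refine Real.rpow_le_rpow (integral_nonneg fun x => Finset.sum_nonneg fun j _ => sq_nonneg _) ?_
    (by norm_num)
  refine integral_mono_of_nonneg
    (Filter.Eventually.of_forall fun x => Finset.sum_nonneg fun j _ => sq_nonneg _) ?_
    (Filter.Eventually.of_forall fun x =>
      Finset.single_le_sum (f := fun i => ∑ j, pdS (fun x => u x i) x j ^ 2)
        (fun i _ => Finset.sum_nonneg fun j _ => sq_nonneg _) (Finset.mem_univ i))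
  exact integrable_finsetSum _ fun i _ => integrable_finsetSum _ fun j _ =>
    int_cc ((cont_pdS (hu i) j).pow 2) (cs_sq (cs_pdS (hs i) j))

lemma pdS_mul {f g : E3 → ℝ} (hf : ContDiff ℝ 1 f) (hg : ContDiff ℝ 1 g) (x : E3) (j : Fin 3) :
    pdS (fun x => f x * g x) x j = f x * pdS g x j + g x * pdS f x j := by
  unfold pdS
  rw [fderiv_fun_mul (hf.differentiable (by norm_num) x) (hg.differentiable (by norm_num) x)]
  simp

lemma ibp_s7 {v T S : E3 → ℝ} (hv : ContDiff ℝ 1 v) (vs : HasCompactSupport v)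
    (hT : ContDiff ℝ 1 T) (hS : ContDiff ℝ 1 S) (Ss : HasCompactSupport S) (Ts : HasCompactSupport T)
    (j : Fin 3) :
    ∫ x, v x * pdS S x j * T x =
      - (∫ x, pdS T x j * (v x * S x)) - ∫ x, pdS v x j * (T x * S x) := by
  have hvT : ContDiff ℝ 1 (fun x => v x * T x) := hv.mul hT
  have cvT : HasCompactSupport (fun x => v x * T x) := vs.mul_right
  have h := integral_mul_fderiv_eq_neg_fderiv_mul_of_integrable (μ := (volume : Measure E3))
    (f := fun x => v x * T x) (g := S) (v := Pi.single j 1)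
    (int_cc ((cont_pdS hvT j).mul hS.continuous) (cs_pdS cvT j).mul_right)
    (int_cc (hvT.continuous.mul (cont_pdS hS j)) cvT.mul_right)
    (int_cc (hvT.continuous.mul hS.continuous) cvT.mul_right)
    (fun x _ => hvT.differentiable (by norm_num) x) (fun x _ => hS.differentiable (by norm_num) x)
  calc _ = ∫ x, v x * T x * fderiv ℝ S x (Pi.single j 1) := by
        congr 1; ext x; unfold pdS; ring
    _ = _ := h
    _ = - ∫ x, (pdS T x j * (v x * S x) + pdS v x j * (T x * S x)) := by
        congr 2; ext x
        have := pdS_mul hv hT x j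
        unfold pdS at this ⊢
        rw [this]; ring
    _ = _ := by
        rw [integral_add]
        · ring
        · exact int_cc ((cont_pdS hT j).mul (hv.continuous.mul hS.continuous)) (cs_pdS Ts j).mul_right
        · exact int_cc ((cont_pdS hv j).mul (hT.continuous.mul hS.continuous)) (cs_pdS vs j).mul_right

lemma bstar_eq {u : E3 → E3} {T S : E3 → ℝ} (hu : ∀ i, ContDiff ℝ 1 (fun x => u x i))
    (us : ∀ i, HasCompactSupport (fun x => u x i))
    (hT : ContDiff ℝ 1 T) (hS : ContDiff ℝ 1 S) (Ss : HasCompactSupport S) (Ts : HasCompactSupport T) :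
    bstar u T S = ∑ j, ((∫ x, pdS T x j * (u x j * S x)) +
      (1 / 2) * ∫ x, pdS (fun x => u x j) x j * (T x * S x)) := by
  have h1 : ∫ x, convS u T x * S x = ∑ j, ∫ x, pdS T x j * (u x j * S x) := by
    rw [← integral_finsetSum]
    · congr 1; ext x
      rw [convS, Finset.sum_mul]
      exact Finset.sum_congr rfl fun j _ => by ring
    · exact fun j _ => int_cc ((cont_pdS hT j).mul ((hu j).continuous.mul hS.continuous))
        (cs_pdS Ts j).mul_right
  have h2 : ∫ x, convS u S x * T x = ∑ j, ∫ x, u x j * pdS S x j * T x := by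
    rw [← integral_finsetSum]
    · congr 1; ext x
      rw [convS, Finset.sum_mul]
    · exact fun j _ => int_cc (((hu j).continuous.mul (cont_pdS hS j)).mul hT.continuous)
        Ts.mul_left
  rw [bstar, h1, h2, Finset.mul_sum, Finset.mul_sum, ← Finset.sum_sub_distrib]
  refine Finset.sum_congr rfl fun j _ => ?_
  rw [ibp_s7 (hu j) (us j) hT hS Ss Ts j]
  ring

/-- For a bounded open `Ω ⊂ ℝ³`, there is `C₆ = C₆(Ω)` such that for every
C¹ vector field `u : ℝ³ → ℝ³` and C¹ scalars `T, S : ℝ³ → ℝ`, all with compact support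
in `Ω`, `|b*(u,T,S)| ≤ C₆ ‖∇u‖ ‖∇T‖ √(‖S‖ ‖∇S‖)`. -/
theorem statement7 (Ω : Set (Fin 3 → ℝ)) (hΩo : IsOpen Ω) (hΩb : Bornology.IsBounded Ω) :
    ∃ C₆ : ℝ, ∀ (u : (Fin 3 → ℝ) → (Fin 3 → ℝ)) (T S : (Fin 3 → ℝ) → ℝ),
      ContDiff ℝ 1 u → ContDiff ℝ 1 T → ContDiff ℝ 1 S →
      HasCompactSupport u → HasCompactSupport T → HasCompactSupport S →
      tsupport u ⊆ Ω → tsupport T ⊆ Ω → tsupport S ⊆ Ω →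
      |bstar u T S| ≤ C₆ * gradNorm u * gradNormS T * Real.sqrt (l2normS S * gradNormS S) := by
  obtain ⟨K, hK, hsob⟩ := sobolev6
  refine ⟨3 * (3 / 2 * (K * Real.sqrt K)), ?_⟩
  intro u T S hu hT hS us Ts Ss _ _ _
  have hu' : ∀ i, ContDiff ℝ 1 (fun x => u x i) := fun i => contDiff_pi.1 hu i
  have us' : ∀ i, HasCompactSupport (fun x => u x i) := fun i =>
    us.comp_left (g := fun v : E3 => v i) (by simp)
  have hl : Real.sqrt (∫ x, S x ^ 2) = l2normS S := by
    rw [l2normS, Real.sqrt_eq_rpow]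
  have nS := gradNormS_nonneg S
  have nT := gradNormS_nonneg T
  have nu : 0 ≤ gradNorm u := (gradNormS_nonneg _).trans (gradNormS_comp_le hu' us' 0)
  have hq : Real.sqrt (Real.sqrt (∫ x, S x ^ 2) * (K * gradNormS S)) =
      Real.sqrt K * Real.sqrt (l2normS S * gradNormS S) := by
    rw [hl, ← Real.sqrt_mul hK]; congr 1; ring
  set q := Real.sqrt (l2normS S * gradNormS S) with hqdef
  have q0 : 0 ≤ q := Real.sqrt_nonneg _
  have A : ∀ j, |∫ x, pdS T x j * (u x j * S x)| ≤
      (K * Real.sqrt K) * gradNorm u * gradNormS T * q := by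
    intro j
    have h := trilin (cont_pdS hT j) (cs_pdS Ts j) (hu' j).continuous (us' j) hS.continuous Ss
      (mul_nonneg hK nS) (mul_nonneg hK (gradNormS_nonneg _)) (hsob S hS Ss)
      (hsob _ (hu' j) (us' j))
    rw [hq] at h
    calc _ ≤ _ := h
      _ ≤ gradNormS T * (K * gradNorm u * (Real.sqrt K * q)) := by
        gcongr
        · exact mul_nonneg (mul_nonneg hK (gradNormS_nonneg _)) (by positivity)
        · exact pdS_le hT Ts j
        · exact gradNormS_comp_le hu' us' j
      _ = _ := by ring
  have B : ∀ j, |∫ x, pdS (fun x => u x j) x j * (T x * S x)| ≤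
      (K * Real.sqrt K) * gradNorm u * gradNormS T * q := by
    intro j
    have h := trilin (cont_pdS (hu' j) j) (cs_pdS (us' j) j) hT.continuous Ts hS.continuous Ss
      (mul_nonneg hK nS) (mul_nonneg hK nT) (hsob S hS Ss) (hsob T hT Ts)
    rw [hq] at h
    calc _ ≤ _ := h
      _ ≤ gradNorm u * (K * gradNormS T * (Real.sqrt K * q)) := by
        gcongr
        exact (pdS_le (hu' j) (us' j) j).trans (gradNormS_comp_le hu' us' j)
      _ = _ := by ring
  rw [bstar_eq hu' us' hT hS Ss Ts]
  refine (Finset.abs_sum_le_sum_abs _ _).trans ?_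
  calc _ ≤ ∑ j : Fin 3, 3 / 2 * ((K * Real.sqrt K) * gradNorm u * gradNormS T * q) := by
        refine Finset.sum_le_sum fun j _ => ?_
        refine (abs_add_le _ _).trans ?_
        rw [abs_mul, abs_of_pos (by norm_num : (0:ℝ) < 1 / 2)]
        linarith [A j, B j]
    _ = _ := by
        rw [Finset.sum_const, Finset.card_univ, Fintype.card_fin]
        simp only [nsmul_eq_mul]; push_cast; ring
end
end
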